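/- Let $n \ge 1$, let $\epsilon \in (0, 1/2]$ and $\delta \ge 0$. Let $\theta^* \in \mathbb{R}^n$ with $\sum_i \theta^*_i = 0$, and let $P_{ij} = e^{\theta^*_j}/(e^{\theta^*_i} + e^{\theta^*_j})$ for $i \ne j$. Suppose $\hat P \in \mathbb{R}^{n\times n}$ satisfies $P_{ij}, \hat P_{ij} \in [\epsilon, 1-\epsilon]$ and $|\hat P_{ij} - P_{ij}| \le \delta$ for all $i \ne j$. Let $\hat\phi_{ij} = \ln(\hat P_{ij}/(1-\hat P_{ij}))$ for $i \ne j$ and $\hat\phi_{ii} = 0$, and let $\hat\theta$ be a minimizer of $\sum_{i,j}(\theta_j - \theta_i - \hat\phi_{ij})^2$ over zero-sum vectors $\theta \in \mathbb{R}^n$. Then $\lVert \hat\theta - \theta^* \rVert_2 \le \delta\, \sqrt{2n}\, /\, \epsilon$. -/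

import Mathlib

open Finset

/-- Pythagoras for least squares: if `r` cannot be shortened by subtracting multiples of `x`,
then `x` is no longer than `x - r`. -/
lemma sum_sq_le_sum_sub_sq_of_forall_le {κ : Type*} [Fintype κ] (r x : κ → ℝ)
    (h : ∀ s : ℝ, ∑ k, r k ^ 2 ≤ ∑ k, (r k - s * x k) ^ 2) :
    ∑ k, x k ^ 2 ≤ ∑ k, (x k - r k) ^ 2 := by
  have hexp (s : ℝ) : ∑ k, (r k - s * x k) ^ 2 =
      ∑ k, r k ^ 2 - 2 * s * ∑ k, r k * x k + s ^ 2 * ∑ k, x k ^ 2 := by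
    simp only [mul_sum, ← sum_sub_distrib, ← sum_add_distrib]
    exact sum_congr rfl fun k _ => by ring
  have hsub : ∑ k, (x k - r k) ^ 2 =
      ∑ k, r k ^ 2 - 2 * ∑ k, r k * x k + ∑ k, x k ^ 2 := by
    simp only [mul_sum, ← sum_sub_distrib, ← sum_add_distrib]
    exact sum_congr rfl fun k _ => by ring
  have hr : 0 ≤ ∑ k, r k ^ 2 := sum_nonneg fun k _ => sq_nonneg _
  have hx : 0 ≤ ∑ k, x k ^ 2 := sum_nonneg fun k _ => sq_nonneg _
  rcases hx.eq_or_lt with hx | hx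
  · rw [← hx]
    exact sum_nonneg fun k _ => sq_nonneg _
  have hs := h ((∑ k, r k * x k) / ∑ k, x k ^ 2)
  rw [hexp] at hs
  rw [hsub]
  generalize ∑ k, x k ^ 2 = C at *
  generalize ∑ k, r k * x k = B at *
  have hmid : 2 * (B / C) * B - (B / C) ^ 2 * C = B ^ 2 / C := by
    field_simp
    ring
  have hB : B ^ 2 / C ≤ 0 := by linarith
  have hB' : B = 0 := by
    rw [div_le_iff₀ hx, zero_mul] at hB
    exact pow_eq_zero_iff two_ne_zero |>.1 (le_antisymm hB (sq_nonneg B))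
  rw [hB']
  linarith

/-- The squared pairwise differences of a zero-sum vector. -/
lemma sum_sum_sub_sq_of_sum_eq_zero {ι : Type*} [Fintype ι] (d : ι → ℝ) (hd : ∑ i, d i = 0) :
    ∑ i, ∑ j, (d j - d i) ^ 2 = 2 * Fintype.card ι * ∑ i, d i ^ 2 := by
  have h (i : ι) : ∑ j, (d j - d i) ^ 2 =
      ∑ j, d j ^ 2 - 2 * d i * ∑ j, d j + Fintype.card ι * d i ^ 2 := by
    have hc : (Fintype.card ι : ℝ) * d i ^ 2 = ∑ _j : ι, d i ^ 2 := by simp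
    rw [hc, mul_sum, ← sum_sub_distrib, ← sum_add_distrib]
    exact sum_congr rfl fun j _ => by ring
  simp only [h, hd, mul_zero, sub_zero, sum_add_distrib, ← mul_sum, sum_const, card_univ,
    nsmul_eq_mul]
  ring

lemma log_sub_log_le_abs_sub_div {ε p q : ℝ} (hε : 0 < ε) (hp : ε ≤ p) (hq : ε ≤ q) :
    Real.log p - Real.log q ≤ |p - q| / ε := by
  have hp0 : 0 < p := hε.trans_le hp
  have hq0 : 0 < q := hε.trans_le hq
  rw [← Real.log_div hp0.ne' hq0.ne']
  calc Real.log (p / q) ≤ p / q - 1 := Real.log_le_sub_one_of_pos (div_pos hp0 hq0)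
    _ = (p - q) / q := by field_simp
    _ ≤ |p - q| / q := by gcongr; exact le_abs_self _
    _ ≤ |p - q| / ε := by gcongr

/-- The logit is `2 / ε`-Lipschitz on `[ε, 1 - ε]`. -/
lemma abs_logit_sub_logit_le {ε p q : ℝ} (hε : 0 < ε) (hp : p ∈ Set.Icc ε (1 - ε))
    (hq : q ∈ Set.Icc ε (1 - ε)) :
    |Real.log (p / (1 - p)) - Real.log (q / (1 - q))| ≤ 2 * |p - q| / ε := by
  obtain ⟨hp, hp'⟩ := hp
  obtain ⟨hq, hq'⟩ := hq
  have h1 := log_sub_log_le_abs_sub_div hε hp hq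
  have h2 := log_sub_log_le_abs_sub_div hε hq hp
  have h3 := log_sub_log_le_abs_sub_div (p := 1 - p) (q := 1 - q) hε (by linarith) (by linarith)
  have h4 := log_sub_log_le_abs_sub_div (p := 1 - q) (q := 1 - p) hε (by linarith) (by linarith)
  rw [sub_sub_sub_cancel_left] at h3 h4
  rw [abs_sub_comm q p] at h2 h3
  rw [Real.log_div (by linarith) (by linarith), Real.log_div (by linarith) (by linarith),
    mul_div_assoc, abs_le]
  constructor <;> linarith

/-- The logit of a Bradley-Terry probability is the difference of the utilities. -/
lemma logit_exp_div_exp_add_exp (a b : ℝ) :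
    Real.log (Real.exp b / (Real.exp a + Real.exp b) /
      (1 - Real.exp b / (Real.exp a + Real.exp b))) = b - a := by
  have ha := Real.exp_pos a
  have hb := Real.exp_pos b
  have h : Real.exp b / (Real.exp a + Real.exp b) /
      (1 - Real.exp b / (Real.exp a + Real.exp b)) = Real.exp (b - a) := by
    rw [one_sub_div (by positivity), add_sub_cancel_right, div_div_div_cancel_right₀ (by positivity),
      Real.exp_sub]
  rw [h, Real.log_exp]

/-- The least squares guarantee: the estimation error of zero-sum utilities is controlled by the
error of the pairwise differences they are fitted to. -/
lemma two_mul_card_mul_sum_sub_sq_le {ι : Type*} [Fintype ι] (φ : ι → ι → ℝ) (θ θ' : ι → ℝ)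
    (hθ : ∑ i, θ i = 0) (hθ' : ∑ i, θ' i = 0)
    (hmin : ∀ η : ι → ℝ, ∑ i, η i = 0 →
      ∑ i, ∑ j, (θ j - θ i - φ i j) ^ 2 ≤ ∑ i, ∑ j, (η j - η i - φ i j) ^ 2) :
    2 * Fintype.card ι * ∑ i, (θ i - θ' i) ^ 2 ≤
      ∑ i, ∑ j, (φ i j - (θ' j - θ' i)) ^ 2 := by
  have hd : ∑ i, (θ i - θ' i) = 0 := by rw [sum_sub_distrib, hθ, hθ', sub_zero]
  rw [← sum_sum_sub_sq_of_sum_eq_zero _ hd]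
  have h := sum_sq_le_sum_sub_sq_of_forall_le
    (fun k : ι × ι => θ k.2 - θ k.1 - φ k.1 k.2)
    (fun k : ι × ι => θ k.2 - θ' k.2 - (θ k.1 - θ' k.1)) (fun s => by
      simp only [Fintype.sum_prod_type]
      refine (hmin (fun i => θ i - s * (θ i - θ' i)) ?_).trans_eq ?_
      · rw [sum_sub_distrib, ← mul_sum, hθ, hd, mul_zero, sub_zero]
      · exact sum_congr rfl fun i _ => sum_congr rfl fun j _ => by ring)
  simp only [Fintype.sum_prod_type] at h
  refine h.trans_eq (sum_congr rfl fun i _ => sum_congr rfl fun j _ => by ring)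

/-- deterministic core of the initialization guarantee: given pairwise
probability estimates uniformly `δ`-accurate and bounded in `[ε, 1-ε]`, the least
squares estimator on the entrywise logits recovers the zero-sum Plackett-Luce utility
vector up to Euclidean error `δ √(2n)/ε`. -/
theorem least_squares_from_pairwise_estimates
    (n : ℕ) (hn : 1 ≤ n) (ε δ : ℝ) (hε : ε ∈ Set.Ioc 0 (1 / 2)) (hδ : 0 ≤ δ)
    (θstar : Fin n → ℝ) (hstar : ∑ i : Fin n, θstar i = 0)
    (P : Fin n → Fin n → ℝ)
    (hPdef : ∀ i j, i ≠ j →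
      P i j = Real.exp (θstar j) / (Real.exp (θstar i) + Real.exp (θstar j)))
    (Phat : Fin n → Fin n → ℝ)
    (hP : ∀ i j, i ≠ j → P i j ∈ Set.Icc ε (1 - ε))
    (hPhat : ∀ i j, i ≠ j → Phat i j ∈ Set.Icc ε (1 - ε))
    (hclose : ∀ i j, i ≠ j → |Phat i j - P i j| ≤ δ)
    (φhat : Fin n → Fin n → ℝ)
    (hφhat : ∀ i j, i ≠ j → φhat i j = Real.log (Phat i j / (1 - Phat i j)))
    (hφhatdiag : ∀ i, φhat i i = 0)
    (θhat : Fin n → ℝ) (hhat : ∑ i : Fin n, θhat i = 0)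
    (hmin : ∀ θ : Fin n → ℝ, (∑ i : Fin n, θ i) = 0 →
      ∑ i : Fin n, ∑ j : Fin n, (θhat j - θhat i - φhat i j) ^ 2 ≤
        ∑ i : Fin n, ∑ j : Fin n, (θ j - θ i - φhat i j) ^ 2) :
    Real.sqrt (∑ i : Fin n, (θhat i - θstar i) ^ 2) ≤ δ * Real.sqrt (2 * n) / ε := by
  have hε0 : 0 < ε := hε.1
  have hn0 : (0 : ℝ) < n := by exact_mod_cast hn
  have herr (i j : Fin n) : (φhat i j - (θstar j - θstar i)) ^ 2 ≤ (2 * δ / ε) ^ 2 := by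
    rcases eq_or_ne i j with rfl | hij
    · rw [hφhatdiag, sub_self, sub_self, zero_pow two_ne_zero]
      positivity
    · have h := abs_logit_sub_logit_le hε0 (hPhat i j hij) (hP i j hij)
      rw [← hφhat i j hij, hPdef i j hij, logit_exp_div_exp_add_exp, ← hPdef i j hij] at h
      refine sq_le_sq' (abs_le.1 ?_).1 (abs_le.1 ?_).2 <;>
      · refine h.trans ?_
        gcongr
        exact hclose i j hij
  have hls := two_mul_card_mul_sum_sub_sq_le φhat θhat θstar hhat hstar hmin
  have hsum : ∑ i, ∑ j, (φhat i j - (θstar j - θstar i)) ^ 2 ≤ n * (n * (2 * δ / ε) ^ 2) := by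
    refine (sum_le_sum fun i _ => sum_le_sum fun j _ => herr i j).trans_eq ?_
    simp
  rw [Fintype.card_fin] at hls
  refine Real.sqrt_le_iff.2 ⟨by positivity, ?_⟩
  rw [div_pow, mul_pow, Real.sq_sqrt (by positivity)]
  refine le_of_mul_le_mul_left ((hls.trans hsum).trans_eq ?_) (by positivity : (0 : ℝ) < 2 * n)
  field_simp
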